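/- arXiv:1507.01430 — 2 statements merged into one kernel-verified Lean document; each statement's English description precedes it below -/
import Mathlib

section
/- Suppose P ∈ 𝔓̄_+ \ {0} and c ∈ ℭ_+. Let Q̂ be the unique minimizer of the continuous dual functional J_P over 𝔓̄_+ \ {0}, and, for every N = (N_1,…,N_d) with min_j N_j sufficiently large (so that c ∈ ℭ_+(N) and a minimizer exists), let Q̂_N be a minimizer of the discrete dual functional J_P^N over 𝔓̄_+(N). Then Q̂_N converges to Q̂ uniformly on 𝕋^d as min_j N_j → ∞. -/
open MeasureTheory Complex Set

noncomputable section

namespace RCE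

/-- The scalar product (k,θ) = Σⱼ kⱼ θⱼ. -/
def dotP (d : ℕ) (k : Fin d → ℤ) (θ : Fin d → ℝ) : ℝ := ∑ j, (k j : ℝ) * θ j

/-- The d-dimensional torus 𝕋^d = (−π,π]^d. -/
def Td (d : ℕ) : Set (Fin d → ℝ) := Set.univ.pi fun _ => Set.Ioc (-Real.pi) Real.pi

/-- Normalized Lebesgue measure dm = (2π)^{-d} dθ on 𝕋^d. -/
def dm (d : ℕ) : Measure (Fin d → ℝ) :=
  (ENNReal.ofReal ((2 * Real.pi) ^ d))⁻¹ • (volume.restrict (Td d))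

/-- Conjugate-symmetric coefficient sequences supported on Λ. -/
def IsCoeff (d : ℕ) (Λ : Finset (Fin d → ℤ)) (p : (Fin d → ℤ) → ℂ) : Prop :=
  (∀ k, k ∉ Λ → p k = 0) ∧ ∀ k, p (-k) = starRingEnd ℂ (p k)

/-- Evaluation of the (real-valued) trigonometric polynomial
`P(e^{iθ}) = Σ_{k∈Λ} p_k e^{-i(k,θ)}`. -/
def eval (d : ℕ) (Λ : Finset (Fin d → ℤ)) (p : (Fin d → ℤ) → ℂ) (θ : Fin d → ℝ) : ℝ :=
  (∑ k ∈ Λ, p k * Complex.exp (-(dotP d k θ : ℂ) * Complex.I)).re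

/-- `𝔓̄₊` : the closed cone of nonnegative trigonometric polynomials. -/
def Pbar (d : ℕ) (Λ : Finset (Fin d → ℤ)) : Set ((Fin d → ℤ) → ℂ) :=
  {p | IsCoeff d Λ p ∧ ∀ θ ∈ Td d, 0 ≤ eval d Λ p θ}

/-- `𝔓₊` : the open cone of positive trigonometric polynomials. -/
def Pplus (d : ℕ) (Λ : Finset (Fin d → ℤ)) : Set ((Fin d → ℤ) → ℂ) :=
  {p | IsCoeff d Λ p ∧ ∀ θ ∈ Td d, 0 < eval d Λ p θ}

/-- The pairing ⟨c,p⟩ = Σ_{k∈Λ} c_k conj(p_k) (real-valued by conjugate symmetry). -/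
def pair (d : ℕ) (Λ : Finset (Fin d → ℤ)) (c p : (Fin d → ℤ) → ℂ) : ℝ :=
  (∑ k ∈ Λ, c k * starRingEnd ℂ (p k)).re

/-- `ℭ₊` : the interior of the dual cone. -/
def Cplus (d : ℕ) (Λ : Finset (Fin d → ℤ)) : Set ((Fin d → ℤ) → ℂ) :=
  {c | IsCoeff d Λ c ∧ ∀ p ∈ Pbar d Λ, p ≠ 0 → 0 < pair d Λ c p}

/-- `ℭ̄₊` : the closed dual cone. -/
def Cbar (d : ℕ) (Λ : Finset (Fin d → ℤ)) : Set ((Fin d → ℤ) → ℂ) :=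
  {c | IsCoeff d Λ c ∧ ∀ p ∈ Pbar d Λ, 0 ≤ pair d Λ c p}

/-- The dual functional J_P(Q) = ⟨c,q⟩ − ∫ P log Q dm. -/
def J (d : ℕ) (Λ : Finset (Fin d → ℤ)) (c P Q : (Fin d → ℤ) → ℂ) : ℝ :=
  pair d Λ c Q - ∫ θ, eval d Λ P θ * Real.log (eval d Λ Q θ) ∂(dm d)

/-- Covariance matching for an absolutely continuous measure Φ dm:
`c_k = ∫ e^{i(k,θ)} Φ(θ) dm(θ)` for all k ∈ Λ. -/
def Matches (d : ℕ) (Λ : Finset (Fin d → ℤ)) (c : (Fin d → ℤ) → ℂ)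
    (Φ : (Fin d → ℝ) → ℝ) : Prop :=
  ∀ k ∈ Λ, c k = ∫ θ, Complex.exp ((dotP d k θ : ℂ) * Complex.I) * (Φ θ : ℂ) ∂(dm d)

/-- The grid point θ_ℓ = (2π ℓ₁/N₁, …, 2π ℓ_d/N_d), so that ζ_ℓ = e^{iθ_ℓ}. -/
def gridθ (d : ℕ) (N : Fin d → ℕ) (L : (j : Fin d) → Fin (N j)) : Fin d → ℝ :=
  fun j => 2 * Real.pi * (L j : ℝ) / (N j : ℝ)

/-- Evaluation of the trigonometric polynomial at the grid point ζ_ℓ. -/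
def evalG (d : ℕ) (Λ : Finset (Fin d → ℤ)) (p : (Fin d → ℤ) → ℂ) (N : Fin d → ℕ)
    (L : (j : Fin d) → Fin (N j)) : ℝ :=
  eval d Λ p (gridθ d N L)

/-- `𝔓̄₊(N)` : polynomials nonnegative on the grid. -/
def PbarN (d : ℕ) (Λ : Finset (Fin d → ℤ)) (N : Fin d → ℕ) : Set ((Fin d → ℤ) → ℂ) :=
  {p | IsCoeff d Λ p ∧ ∀ L : (j : Fin d) → Fin (N j), 0 ≤ evalG d Λ p N L}

/-- `𝔓₊(N)` : polynomials positive on the grid. -/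
def PplusN (d : ℕ) (Λ : Finset (Fin d → ℤ)) (N : Fin d → ℕ) : Set ((Fin d → ℤ) → ℂ) :=
  {p | IsCoeff d Λ p ∧ ∀ L : (j : Fin d) → Fin (N j), 0 < evalG d Λ p N L}

/-- `ℭ₊(N)` : the interior of the dual cone of `𝔓̄₊(N)`. -/
def CplusN (d : ℕ) (Λ : Finset (Fin d → ℤ)) (N : Fin d → ℕ) : Set ((Fin d → ℤ) → ℂ) :=
  {c | IsCoeff d Λ c ∧ ∀ p ∈ PbarN d Λ N, p ≠ 0 → 0 < pair d Λ c p}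

/-- The discrete dual functional J_P^N(Q) = ⟨c,q⟩ − (Π_j N_j)⁻¹ Σ_ℓ P(ζ_ℓ) log Q(ζ_ℓ),
with the convention P(ζ_ℓ) log Q(ζ_ℓ) := 0 whenever P(ζ_ℓ) = 0. -/
def JN (d : ℕ) (Λ : Finset (Fin d → ℤ)) (N : Fin d → ℕ) (c P Q : (Fin d → ℤ) → ℂ) : ℝ :=
  pair d Λ c Q - (∏ j, (N j : ℝ))⁻¹ *
    ∑ L : (j : Fin d) → Fin (N j),
      (if evalG d Λ P N L = 0 then 0 else evalG d Λ P N L * Real.log (evalG d Λ Q N L))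

/-- The effective domain of J_P^N on `𝔓̄₊(N) \ {0}` : those Q for which the (extended-real
valued) functional J_P^N(Q) is finite, i.e. Q(ζ_ℓ) ≠ 0 whenever P(ζ_ℓ) ≠ 0.  Minimizing
J_P^N over `𝔓̄₊(N)` is the same as minimizing it over this set. -/
def domN (d : ℕ) (Λ : Finset (Fin d → ℤ)) (N : Fin d → ℕ) (P : (Fin d → ℤ) → ℂ) :
    Set ((Fin d → ℤ) → ℂ) :=
  {Q | Q ∈ PbarN d Λ N ∧ Q ≠ 0 ∧
    ∀ L : (j : Fin d) → Fin (N j), evalG d Λ P N L = 0 ∨ evalG d Λ Q N L ≠ 0}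

lemma dotP_add_smul (d : ℕ) (k : Fin d → ℤ) (x v : Fin d → ℝ) (t : ℝ) :
    dotP d k (x + t • v) = dotP d k x + t * dotP d k v := by
  simp only [dotP, Pi.add_apply, Pi.smul_apply, smul_eq_mul, mul_add, Finset.sum_add_distrib,
    Finset.mul_sum]
  congr 1
  exact Finset.sum_congr rfl fun j _ => by ring

lemma dotP_neg (d : ℕ) (k : Fin d → ℤ) (x : Fin d → ℝ) : dotP d (-k) x = -dotP d k x := by
  simp [dotP]

/-- Conjugate symmetry makes the trigonometric sum real. -/
lemma ofReal_eval {d : ℕ} {Λ : Finset (Fin d → ℤ)} (hΛ : ∀ k ∈ Λ, -k ∈ Λ)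
    {p : (Fin d → ℤ) → ℂ} (hp : IsCoeff d Λ p) (θ : Fin d → ℝ) :
    (eval d Λ p θ : ℂ) = ∑ k ∈ Λ, p k * Complex.exp (-(dotP d k θ : ℂ) * Complex.I) := by
  rw [eval, ← Complex.conj_eq_iff_re, map_sum]
  refine Finset.sum_nbij' (fun k => -k) (fun k => -k) hΛ hΛ (by simp) (by simp) fun k _ => ?_
  rw [map_mul, hp.2 k, ← Complex.exp_conj, dotP_neg]
  simp

/-- Some direction separates the finitely many frequencies in `Λ`. -/
lemma exists_separating_direction (d : ℕ) (Λ : Finset (Fin d → ℤ)) :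
    ∃ v : Fin d → ℝ, ∀ k ∈ Λ, ∀ l ∈ Λ, dotP d k v = dotP d l v → k = l := by
  classical
  let S (q : (Fin d → ℤ) × (Fin d → ℤ)) : Submodule ℝ (Fin d → ℝ) :=
    LinearMap.ker (∑ j, ((q.1 j : ℝ) - q.2 j) • LinearMap.proj (R := ℝ) (φ := fun _ => ℝ) j)
  have hS (q) (v) : v ∈ S q ↔ dotP d q.1 v = dotP d q.2 v := by
    simp [S, dotP, sub_mul, sub_eq_zero]
  have hne := Subspace.biUnion_ne_univ_of_top_notMem
    (s := ((Λ ×ˢ Λ).filter fun q => q.1 ≠ q.2).image S) (by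
      simp only [Finset.mem_image, Finset.mem_filter, not_exists, not_and]
      rintro ⟨k, l⟩ ⟨-, hkl⟩ htop
      refine hkl (funext fun j => ?_)
      have : Pi.single j 1 ∈ S (k, l) := htop ▸ Submodule.mem_top
      rw [hS] at this
      simpa [dotP, Pi.single_apply] using this)
  obtain ⟨v, hv⟩ := (Set.ne_univ_iff_exists_notMem _).1 hne
  refine ⟨v, fun k hk l hl h => ?_⟩
  by_contra hkl
  apply hv
  simp only [Finset.mem_image, Set.mem_iUnion, exists_prop]
  exact ⟨S (k, l), ⟨(k, l), by simp [hk, hl, hkl], rfl⟩, (hS _ _).2 h⟩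

/-- The character `t ↦ exp (-i a t)` of the real line. -/
def lineChar (a : ℝ) : Multiplicative ℝ →* ℂ where
  toFun t := Complex.exp (-(t.toAdd * a : ℂ) * Complex.I)
  map_one' := by simp
  map_mul' s t := by
    rw [← Complex.exp_add]
    congr 1
    simp
    ring

lemma lineChar_injective : Function.Injective lineChar := by
  intro a b h
  have h1 : ∀ t : ℝ, Complex.exp ((t * (-Complex.I * a))) = Complex.exp (t * (-Complex.I * b)) := by
    intro t
    have := DFunLike.congr_fun h (Multiplicative.ofAdd t)
    simp only [lineChar, MonoidHom.coe_mk, OneHom.coe_mk, toAdd_ofAdd] at this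
    convert this using 2 <;> ring
  have hd (z : ℂ) : HasDerivAt (fun t : ℝ => Complex.exp (t * z)) z 0 := by
    have : HasDerivAt (fun t : ℝ => (t : ℂ) * z) (1 * z) 0 :=
      (Complex.ofRealCLM.hasDerivAt (x := (0 : ℝ))).mul_const z
    simpa using this.cexp
  have := (hd (-Complex.I * a)).unique ((hd (-Complex.I * b)).congr_of_eventuallyEq
    (Filter.Eventually.of_forall h1))
  simpa using this

lemma continuous_eval (d : ℕ) (Λ : Finset (Fin d → ℤ)) (p : (Fin d → ℤ) → ℂ) :
    Continuous (eval d Λ p) := by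
  unfold eval dotP
  fun_prop

/-- A nonzero trigonometric polynomial vanishes only on a null set. -/
lemma ae_eval_ne_zero {d : ℕ} {Λ : Finset (Fin d → ℤ)} (hΛ : ∀ k ∈ Λ, -k ∈ Λ)
    {p : (Fin d → ℤ) → ℂ} (hp : IsCoeff d Λ p) (hp0 : p ≠ 0) :
    ∀ᵐ θ ∂(dm d), eval d Λ p θ ≠ 0 := by
  suffices h : ∀ᵐ θ : Fin d → ℝ, eval d Λ p θ ≠ 0 from
    Measure.ae_smul_measure (ae_restrict_of_ae h) _
  obtain ⟨v, hv⟩ := exists_separating_direction d Λ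
  refine ae_mem_of_ae_add_linearMap_mem (LinearMap.toSpanSingleton ℝ (Fin d → ℝ) v) volume volume
    (s := {θ | eval d Λ p θ ≠ 0})
    ((continuous_eval d Λ p).measurable (measurableSet_singleton 0).compl) fun x => ?_
  have hline (t : ℝ) : ((eval d Λ p (x + t • v) : ℝ) : ℂ) =
      ∑ k ∈ Λ, (p k * Complex.exp (-(dotP d k x : ℂ) * Complex.I)) *
        lineChar (dotP d k v) (Multiplicative.ofAdd t) := by
    rw [ofReal_eval hΛ hp]
    refine Finset.sum_congr rfl fun k _ => ?_
    rw [dotP_add_smul, mul_assoc]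
    simp only [lineChar, MonoidHom.coe_mk, OneHom.coe_mk, toAdd_ofAdd]
    rw [← Complex.exp_add]
    congr 2
    push_cast
    ring
  have han : AnalyticOnNhd ℝ (fun t : ℝ => eval d Λ p (x + t • v)) Set.univ := by
    intro t _
    have hof : AnalyticAt ℝ (fun s : ℝ => (s : ℂ)) t := Complex.ofRealCLM.analyticAt t
    simp only [eval, dotP_add_smul]
    refine (Complex.reCLM.analyticAt _).comp (Finset.analyticAt_fun_sum _ fun k _ => ?_)
    push_cast
    exact analyticAt_const.mul (analyticAt_cexp.restrictScalars.comp
      (((analyticAt_const.add (hof.mul analyticAt_const)).neg).mul analyticAt_const))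
  obtain ⟨t₀, ht₀⟩ : ∃ t : ℝ, eval d Λ p (x + t • v) ≠ 0 := by
    by_contra! hzero
    have hli : LinearIndependent ℂ
        (fun k : Λ => (lineChar (dotP d k v) : Multiplicative ℝ → ℂ)) :=
      (linearIndependent_monoidHom (Multiplicative ℝ) ℂ).comp
        (fun k : Λ => lineChar (dotP d k v))
        fun k l h => Subtype.ext (hv k k.2 l l.2 (lineChar_injective h))
    rw [Fintype.linearIndependent_iff] at hli
    have h0 := hli (fun k => p k * Complex.exp (-(dotP d k x : ℂ) * Complex.I)) (by
      funext t
      have := (hline t.toAdd).symm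
      rw [hzero, Complex.ofReal_zero, ← Finset.sum_coe_sort] at this
      simpa using this)
    refine hp0 (funext fun k => ?_)
    by_cases hk : k ∈ Λ
    · simpa using h0 ⟨k, hk⟩
    · exact hp.1 k hk
  have := ae_restrict_le_codiscreteWithin (μ := (volume : Measure ℝ)) MeasurableSet.univ
    (han.preimage_zero_mem_codiscrete ht₀)
  rw [Measure.restrict_univ] at this
  exact this

instance fact_two_pi_pos : Fact (0 < 2 * Real.pi) := ⟨Real.two_pi_pos⟩

/-- The torus as a compact group. -/
abbrev Tor (d : ℕ) : Type := Fin d → AddCircle (2 * Real.pi)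

/-- The projection of `ℝ^d` onto the torus. -/
def proj (d : ℕ) (θ : Fin d → ℝ) : Tor d := fun j => (θ j : AddCircle (2 * Real.pi))

lemma continuous_proj (d : ℕ) : Continuous (proj d) :=
  continuous_pi fun j => (AddCircle.continuous_mk' _).comp (continuous_apply j)

/-- A trigonometric polynomial as a function on the torus group. -/
def torEval (d : ℕ) (Λ : Finset (Fin d → ℤ)) (p : (Fin d → ℤ) → ℂ) (x : Tor d) : ℝ :=
  (∑ k ∈ Λ, p k * ∏ j, fourier (-k j) (x j)).re

lemma continuous_torEval (d : ℕ) (Λ : Finset (Fin d → ℤ)) (p : (Fin d → ℤ) → ℂ) :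
    Continuous (torEval d Λ p) := by
  unfold torEval
  fun_prop

lemma torEval_proj (d : ℕ) (Λ : Finset (Fin d → ℤ)) (p : (Fin d → ℤ) → ℂ) (θ : Fin d → ℝ) :
    torEval d Λ p (proj d θ) = eval d Λ p θ := by
  unfold torEval eval proj dotP
  congr 1
  refine Finset.sum_congr rfl fun k _ => ?_
  congr 1
  simp only [fourier_coe_apply]
  rw [← Complex.exp_sum]
  congr 1
  push_cast
  rw [← Finset.sum_neg_distrib, Finset.sum_mul]
  refine Finset.sum_congr rfl fun j _ => ?_
  have : (Real.pi : ℂ) ≠ 0 := by exact_mod_cast Real.pi_ne_zero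
  field_simp

lemma exists_Td_proj_eq (d : ℕ) (x : Tor d) : ∃ θ ∈ Td d, proj d θ = x := by
  have h (j : Fin d) : ∃ t ∈ Set.Ioc (-Real.pi) Real.pi, (t : AddCircle (2 * Real.pi)) = x j := by
    have := AddCircle.coe_image_Ioc_eq (2 * Real.pi) (-Real.pi)
    rw [show -Real.pi + 2 * Real.pi = Real.pi by ring] at this
    exact (Set.eq_univ_iff_forall.1 this) (x j)
  choose θ hθ hx using h
  exact ⟨θ, fun j _ => hθ j, funext hx⟩

lemma measurePreserving_proj (d : ℕ) :
    MeasurePreserving (proj d) (volume.restrict (Td d)) volume := by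
  have h (_ : Fin d) := AddCircle.measurePreserving_mk (2 * Real.pi) (-Real.pi)
  rw [show -Real.pi + 2 * Real.pi = Real.pi by ring] at h
  have := measurePreserving_pi _ _ h
  rwa [← Measure.restrict_pi_pi] at this

instance isProbabilityMeasure_dm (d : ℕ) : IsProbabilityMeasure (dm d) := by
  constructor
  rw [dm, Measure.smul_apply, Measure.restrict_apply_univ, Td, Real.volume_pi_Ioc]
  have : Real.pi - -Real.pi = 2 * Real.pi := by ring
  simp only [this, Finset.prod_const, Finset.card_univ, Fintype.card_fin, smul_eq_mul]
  rw [← ENNReal.ofReal_pow Real.two_pi_pos.le]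
  exact ENNReal.inv_mul_cancel (by simpa using pow_pos Real.two_pi_pos d) ENNReal.ofReal_ne_top

lemma integrable_proj (d : ℕ) (G : Tor d → ℝ) (hG : Continuous G) :
    Integrable (fun θ => G (proj d θ)) (dm d) := by
  obtain ⟨C, hC⟩ := isCompact_univ.exists_bound_of_continuousOn hG.continuousOn
  exact Integrable.of_bound (hG.comp (continuous_proj d)).aestronglyMeasurable C
    (Filter.Eventually.of_forall fun θ => hC _ (Set.mem_univ _))

/-- Integrals of periodic functions are invariant under translation. -/
lemma integral_proj_add (d : ℕ) (F : Tor d → ℝ) (hF : Continuous F) (a : Tor d) :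
    ∫ θ, F (proj d θ + a) ∂(dm d) = ∫ θ, F (proj d θ) ∂(dm d) := by
  have h (G : Tor d → ℝ) (hG : Continuous G) :
      ∫ θ in Td d, G (proj d θ) = ∫ x, G x := by
    rw [← (measurePreserving_proj d).map_eq,
      integral_map (continuous_proj d).aemeasurable hG.aestronglyMeasurable]
  simp only [dm, integral_smul_measure]
  rw [h F hF, h (fun x => F (x + a)) (by fun_prop), integral_add_right_eq_self]

/-- The mean value over the grid. -/
def gmean (d : ℕ) (N : Fin d → ℕ) (f : (Fin d → ℝ) → ℝ) : ℝ :=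
  (∏ j, (N j : ℝ))⁻¹ * ∑ L : (j : Fin d) → Fin (N j), f (gridθ d N L)

lemma proj_gridθ_add (d : ℕ) (N : Fin d → ℕ) [∀ j, NeZero (N j)]
    (L L' : (j : Fin d) → Fin (N j)) :
    proj d (gridθ d N (L + L')) = proj d (gridθ d N L) + proj d (gridθ d N L') := by
  funext j
  simp only [proj, gridθ, Pi.add_apply, Fin.val_add]
  rw [← AddCircle.coe_add, ← sub_eq_zero, ← AddCircle.coe_sub, AddCircle.coe_eq_zero_iff]
  refine ⟨-(((L j + L' j : ℕ) / N j : ℕ) : ℤ), ?_⟩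
  have h : ((L j : ℝ) + L' j) = N j * (((L j + L' j : ℕ) / N j : ℕ) : ℝ)
      + (((L j + L' j : ℕ) % N j : ℕ) : ℝ) := by
    exact_mod_cast (Nat.div_add_mod _ _).symm
  have hN : (N j : ℝ) ≠ 0 := Nat.cast_ne_zero.2 (NeZero.ne _)
  rw [zsmul_eq_mul, Int.cast_neg, Int.cast_natCast]
  generalize (((L j + L' j : ℕ) / N j : ℕ) : ℝ) = q at h ⊢
  generalize (((L j + L' j : ℕ) % N j : ℕ) : ℝ) = r at h ⊢
  field_simp
  linear_combination h

/-- Every point of the torus lies close to the grid. -/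
lemma exists_grid_close (d : ℕ) (N : Fin d → ℕ) (hN : ∀ j, 0 < N j) {η : ℝ} (hη : 0 < η)
    (hNη : ∀ j, 2 * Real.pi / N j < η) (x : Tor d) :
    ∃ L : (j : Fin d) → Fin (N j), dist x (proj d (gridθ d N L)) < η := by
  have h (j : Fin d) : ∃ l : Fin (N j),
      dist (x j) ((2 * Real.pi * (l : ℝ) / (N j : ℝ) : ℝ) : AddCircle (2 * Real.pi)) < η := by
    have hx := (AddCircle.coe_image_Ico_eq (2 * Real.pi) 0).symm ▸ Set.mem_univ (x j)
    obtain ⟨t, ht, htx⟩ := hx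
    rw [zero_add] at ht
    have hp := Real.two_pi_pos
    have hNj : (0 : ℝ) < N j := Nat.cast_pos.2 (hN j)
    have hu : 0 ≤ t * N j / (2 * Real.pi) := by have := ht.1; positivity
    have h1 := Nat.floor_le hu
    have h2 := Nat.lt_floor_add_one (t * N j / (2 * Real.pi))
    have hlt : ⌊t * N j / (2 * Real.pi)⌋₊ < N j := by
      rw [Nat.floor_lt hu, div_lt_iff₀ hp, mul_comm]
      exact mul_lt_mul_of_pos_left ht.2 hNj
    refine ⟨⟨_, hlt⟩, lt_of_le_of_lt ?_ (hNη j)⟩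
    rw [← htx, dist_eq_norm, ← AddCircle.coe_sub]
    refine (QuotientAddGroup.norm_mk_le_norm).trans ?_
    set m : ℝ := (⌊t * N j / (2 * Real.pi)⌋₊ : ℝ)
    rw [le_div_iff₀ hp] at h1
    rw [div_lt_iff₀ hp] at h2
    rw [Real.norm_eq_abs, abs_le]
    constructor
    · rw [← sub_nonneg]
      have : t - 2 * Real.pi * m / N j - -(2 * Real.pi / N j)
        = (t * N j - m * (2 * Real.pi) + 2 * Real.pi) / N j := by field_simp; ring
      rw [this]
      apply div_nonneg _ hNj.le
      linarith
    · rw [sub_le_iff_le_add, ← add_div, le_div_iff₀ hNj]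
      linarith
  choose L hL using h
  exact ⟨L, (dist_pi_lt_iff hη).2 hL⟩

lemma eventually_grid_fine (d : ℕ) {η : ℝ} (hη : 0 < η) :
    ∀ᶠ N : Fin d → ℕ in Filter.atTop, (∀ j, 0 < N j) ∧ ∀ j, 2 * Real.pi / N j < η := by
  obtain ⟨M, hM⟩ := exists_nat_gt (2 * Real.pi / η)
  filter_upwards [Filter.eventually_ge_atTop (fun _ => M + 1)] with N hN
  have hj (j) : (M : ℝ) + 1 ≤ N j := by exact_mod_cast hN j
  refine ⟨fun j => (Nat.succ_pos M).trans_le (hN j), fun j => ?_⟩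
  have hpos : (0 : ℝ) < N j := lt_of_lt_of_le (by positivity) (hj j)
  rw [div_lt_iff₀ hη] at hM
  rw [div_lt_iff₀ hpos]
  nlinarith [hj j]

/-- Riemann sums over the grid converge. -/
lemma tendsto_gmean (d : ℕ) (F : Tor d → ℝ) (hF : Continuous F) :
    Filter.Tendsto (fun N => gmean d N fun θ => F (proj d θ)) Filter.atTop
      (nhds (∫ θ, F (proj d θ) ∂(dm d))) := by
  rw [Metric.tendsto_nhds]
  intro ε hε
  obtain ⟨η, hη, hFη⟩ := Metric.uniformContinuous_iff.1
    (CompactSpace.uniformContinuous_of_continuous hF) (ε / 2) (half_pos hε)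
  filter_upwards [eventually_grid_fine d hη] with N ⟨hN, hNη⟩
  have (j : Fin d) : NeZero (N j) := ⟨(hN j).ne'⟩
  have hcard : (0 : ℝ) < ∏ j, (N j : ℝ) := Finset.prod_pos fun j _ => Nat.cast_pos.2 (hN j)
  let A (x : Tor d) : ℝ := (∏ j, (N j : ℝ))⁻¹ *
    ∑ L : (j : Fin d) → Fin (N j), F (proj d (gridθ d N L) + x)
  have hA0 : gmean d N (fun θ => F (proj d θ)) = A 0 := by simp [A, gmean]
  have hshift (x : Tor d) (L' : (j : Fin d) → Fin (N j)) :
      A (x + proj d (gridθ d N L')) = A x := by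
    simp only [A]
    congr 1
    rw [← Equiv.sum_comp (Equiv.addRight L') (fun L => F (proj d (gridθ d N L) + x))]
    refine Finset.sum_congr rfl fun L _ => ?_
    rw [Equiv.coe_addRight, proj_gridθ_add]
    congr 1
    abel
  have hclose (x : Tor d) : ‖A x - A 0‖ ≤ ε / 2 := by
    obtain ⟨L', hL'⟩ := exists_grid_close d N hN hη hNη x
    rw [← hshift 0 L', Real.norm_eq_abs]
    simp only [A]
    rw [← mul_sub, ← Finset.sum_sub_distrib, abs_mul, abs_of_pos (inv_pos.2 hcard),
      inv_mul_le_iff₀ hcard]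
    refine (Finset.abs_sum_le_sum_abs _ _).trans ((Finset.sum_le_card_nsmul _ _ (ε / 2)
      fun L _ => ?_).trans ?_)
    · refine (hFη ?_).le
      simpa using hL'
    · simp
  have hAc : Continuous A := by
    simp only [A]
    fun_prop
  have hmean : ∫ θ, A (proj d θ) ∂(dm d) = ∫ θ, F (proj d θ) ∂(dm d) := by
    simp only [A]
    rw [integral_const_mul, integral_finsetSum _ fun L _ =>
      integrable_proj d (fun x => F (proj d (gridθ d N L) + x)) (by fun_prop)]
    simp_rw [add_comm (proj d (gridθ d N _)), integral_proj_add d F hF]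
    simp [hcard.ne']
  rw [hA0, ← hmean, dist_comm, dist_eq_norm]
  have : ∫ θ, A (proj d θ) ∂(dm d) - A 0 = ∫ θ, (A (proj d θ) - A 0) ∂(dm d) := by
    rw [integral_sub (integrable_proj d A hAc) (integrable_const _)]
    simp
  rw [this]
  refine lt_of_le_of_lt (norm_integral_le_of_norm_le_const (C := ε / 2)
    (Filter.Eventually.of_forall fun θ => hclose _)) ?_
  simp only [probReal_univ, mul_one]
  linarith

lemma gmean_mono (d : ℕ) (N : Fin d → ℕ) {f g : (Fin d → ℝ) → ℝ}
    (h : ∀ L, f (gridθ d N L) ≤ g (gridθ d N L)) : gmean d N f ≤ gmean d N g := by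
  unfold gmean
  gcongr with L
  exact h L

lemma gmean_add_const (d : ℕ) (N : Fin d → ℕ) (hN : ∀ j, 0 < N j) (f : (Fin d → ℝ) → ℝ) (a : ℝ) :
    gmean d N (fun θ => f θ + a) = gmean d N f + a := by
  have hcard : (∏ j, (N j : ℝ)) ≠ 0 :=
    Finset.prod_ne_zero_iff.2 fun j _ => Nat.cast_ne_zero.2 (hN j).ne'
  simp only [gmean, Finset.sum_add_distrib, mul_add]
  congr 1
  simp [hcard]

lemma JN_eq (d : ℕ) (Λ : Finset (Fin d → ℤ)) (N : Fin d → ℕ) (c P Q : (Fin d → ℤ) → ℂ) :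
    JN d Λ N c P Q =
      pair d Λ c Q - gmean d N fun θ => eval d Λ P θ * Real.log (eval d Λ Q θ) := by
  unfold JN gmean evalG
  congr 2
  refine Finset.sum_congr rfl fun L _ => ?_
  split_ifs with h <;> simp [h]

lemma eval_add (d : ℕ) (Λ : Finset (Fin d → ℤ)) (p q : (Fin d → ℤ) → ℂ) (θ : Fin d → ℝ) :
    eval d Λ (p + q) θ = eval d Λ p θ + eval d Λ q θ := by
  simp [eval, add_mul, Finset.sum_add_distrib]

lemma eval_sub (d : ℕ) (Λ : Finset (Fin d → ℤ)) (p q : (Fin d → ℤ) → ℂ) (θ : Fin d → ℝ) :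
    eval d Λ (p - q) θ = eval d Λ p θ - eval d Λ q θ := by
  simp only [eval, Pi.sub_apply, sub_mul, Finset.sum_sub_distrib, Complex.sub_re]

lemma eval_smul (d : ℕ) (Λ : Finset (Fin d → ℤ)) (r : ℝ) (p : (Fin d → ℤ) → ℂ) (θ : Fin d → ℝ) :
    eval d Λ (r • p) θ = r * eval d Λ p θ := by
  simp only [eval, Pi.smul_apply, Complex.real_smul, mul_assoc, ← Finset.mul_sum,
    Complex.re_ofReal_mul]

lemma pair_add (d : ℕ) (Λ : Finset (Fin d → ℤ)) (c p q : (Fin d → ℤ) → ℂ) :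
    pair d Λ c (p + q) = pair d Λ c p + pair d Λ c q := by
  simp only [pair, Pi.add_apply, map_add, mul_add, Finset.sum_add_distrib, Complex.add_re]

lemma pair_smul (d : ℕ) (Λ : Finset (Fin d → ℤ)) (c : (Fin d → ℤ) → ℂ) (r : ℝ)
    (p : (Fin d → ℤ) → ℂ) : pair d Λ c (r • p) = r * pair d Λ c p := by
  simp only [pair, Pi.smul_apply, Complex.real_smul, map_mul, Complex.conj_ofReal,
    mul_left_comm _ (r : ℂ), ← Finset.mul_sum, Complex.re_ofReal_mul]

lemma continuous_pair (d : ℕ) (Λ : Finset (Fin d → ℤ)) (c : (Fin d → ℤ) → ℂ) :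
    Continuous (pair d Λ c) := by
  unfold pair
  fun_prop

/-- The constant trigonometric polynomial. -/
def cst (d : ℕ) (a : ℝ) : (Fin d → ℤ) → ℂ := Pi.single 0 (a : ℂ)

lemma eval_cst {d : ℕ} {Λ : Finset (Fin d → ℤ)} (h0 : (0 : Fin d → ℤ) ∈ Λ) (a : ℝ)
    (θ : Fin d → ℝ) : eval d Λ (cst d a) θ = a := by
  unfold eval
  rw [Finset.sum_eq_single_of_mem 0 h0 fun k _ hk => by simp [cst, hk]]
  simp [cst, dotP]

lemma pair_cst {d : ℕ} {Λ : Finset (Fin d → ℤ)} (h0 : (0 : Fin d → ℤ) ∈ Λ)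
    (c : (Fin d → ℤ) → ℂ) (a : ℝ) : pair d Λ c (cst d a) = a * (c 0).re := by
  unfold pair
  rw [Finset.sum_eq_single_of_mem 0 h0 fun k _ hk => by simp [cst, hk]]
  simp [cst, mul_comm]

lemma isCoeff_cst {d : ℕ} {Λ : Finset (Fin d → ℤ)} (h0 : (0 : Fin d → ℤ) ∈ Λ) (a : ℝ) :
    IsCoeff d Λ (cst d a) := by
  refine ⟨fun k hk => ?_, fun k => ?_⟩
  · have : k ≠ 0 := fun h => hk (h ▸ h0)
    simp [cst, this]
  · by_cases hk : k = 0 <;> simp [cst, hk]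

lemma IsCoeff.add {d : ℕ} {Λ : Finset (Fin d → ℤ)} {p q : (Fin d → ℤ) → ℂ}
    (hp : IsCoeff d Λ p) (hq : IsCoeff d Λ q) : IsCoeff d Λ (p + q) :=
  ⟨fun k hk => by simp [hp.1 k hk, hq.1 k hk], fun k => by simp [hp.2, hq.2]⟩

lemma IsCoeff.sub {d : ℕ} {Λ : Finset (Fin d → ℤ)} {p q : (Fin d → ℤ) → ℂ}
    (hp : IsCoeff d Λ p) (hq : IsCoeff d Λ q) : IsCoeff d Λ (p - q) :=
  ⟨fun k hk => by simp [hp.1 k hk, hq.1 k hk], fun k => by simp [hp.2, hq.2]⟩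

lemma IsCoeff.smul {d : ℕ} {Λ : Finset (Fin d → ℤ)} {p : (Fin d → ℤ) → ℂ}
    (hp : IsCoeff d Λ p) (r : ℝ) : IsCoeff d Λ (r • p) :=
  ⟨fun k hk => by simp [hp.1 k hk], fun k => by simp [hp.2]⟩

/-- The `ℓ¹` norm of the coefficients. -/
def nrm (d : ℕ) (Λ : Finset (Fin d → ℤ)) (p : (Fin d → ℤ) → ℂ) : ℝ := ∑ k ∈ Λ, ‖p k‖

lemma nrm_nonneg (d : ℕ) (Λ : Finset (Fin d → ℤ)) (p : (Fin d → ℤ) → ℂ) : 0 ≤ nrm d Λ p :=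
  Finset.sum_nonneg fun _ _ => norm_nonneg _

lemma continuous_nrm (d : ℕ) (Λ : Finset (Fin d → ℤ)) : Continuous (nrm d Λ) := by
  unfold nrm
  fun_prop

lemma abs_eval_le (d : ℕ) (Λ : Finset (Fin d → ℤ)) (p : (Fin d → ℤ) → ℂ) (θ : Fin d → ℝ) :
    |eval d Λ p θ| ≤ nrm d Λ p := by
  refine (Complex.abs_re_le_norm _).trans ((norm_sum_le _ _).trans (Finset.sum_le_sum fun k _ => ?_))
  rw [norm_mul, ← Complex.ofReal_neg, Complex.norm_exp_ofReal_mul_I, mul_one]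

lemma tendsto_nrm_sub {ι : Type*} {l : Filter ι} (d : ℕ) (Λ : Finset (Fin d → ℤ))
    {q : ι → (Fin d → ℤ) → ℂ} {q' : (Fin d → ℤ) → ℂ} (h : Filter.Tendsto q l (nhds q')) :
    Filter.Tendsto (fun i => nrm d Λ (q i - q')) l (nhds 0) := by
  have := ((continuous_nrm d Λ).tendsto _).comp (h.sub_const q')
  simpa [Function.comp_def, nrm] using this

lemma eval_nonneg {d : ℕ} {Λ : Finset (Fin d → ℤ)} {p : (Fin d → ℤ) → ℂ} (hp : p ∈ Pbar d Λ)
    (θ : Fin d → ℝ) : 0 ≤ eval d Λ p θ := by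
  obtain ⟨θ', hθ', h⟩ := exists_Td_proj_eq d (proj d θ)
  rw [← torEval_proj, ← h, torEval_proj]
  exact hp.2 θ' hθ'

lemma pos_mem_Pbar {d : ℕ} {Λ : Finset (Fin d → ℤ)} {p : (Fin d → ℤ) → ℂ} (hp : IsCoeff d Λ p)
    (h : ∀ θ, 0 < eval d Λ p θ) : p ∈ Pbar d Λ \ {0} := by
  refine ⟨⟨hp, fun θ _ => (h θ).le⟩, ?_⟩
  rintro rfl
  simpa [eval] using h 0

/-- Nonnegativity on finer and finer grids passes to the limit as nonnegativity everywhere. -/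
lemma mem_Pbar_of_tendsto {d : ℕ} {Λ : Finset (Fin d → ℤ)} {l : Filter (Fin d → ℕ)} [l.NeBot]
    (hl : l ≤ Filter.atTop) {q : (Fin d → ℕ) → (Fin d → ℤ) → ℂ} {q' : (Fin d → ℤ) → ℂ}
    (hq : ∀ᶠ N in l, q N ∈ PbarN d Λ N) (h : Filter.Tendsto q l (nhds q')) : q' ∈ Pbar d Λ := by
  have hk (k) : Filter.Tendsto (fun N => q N k) l (nhds (q' k)) := tendsto_pi_nhds.1 h k
  refine ⟨⟨fun k hkΛ => ?_, fun k => ?_⟩, fun θ _ => ?_⟩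
  · exact tendsto_nhds_unique_of_eventuallyEq (hk k) tendsto_const_nhds
      (hq.mono fun N hN => hN.1.1 k hkΛ)
  · exact tendsto_nhds_unique_of_eventuallyEq (hk (-k))
      ((Complex.continuous_conj.tendsto _).comp (hk k)) (hq.mono fun N hN => hN.1.2 k)
  · by_contra! hneg
    obtain ⟨η, hη, hball⟩ := Metric.continuous_iff.1 (continuous_torEval d Λ q') (proj d θ)
      (-eval d Λ q' θ / 2) (by linarith)
    have hsmall := (tendsto_nrm_sub d Λ h).eventually_lt_const
      (show 0 < -eval d Λ q' θ / 2 by linarith)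
    obtain ⟨N, ⟨hN, hNη⟩, hqN, hsm⟩ :=
      ((Filter.Eventually.filter_mono hl (eventually_grid_fine d hη)).and (hq.and hsmall)).exists
    obtain ⟨L, hL⟩ := exists_grid_close d N hN hη hNη (proj d θ)
    have h1 := hball _ (by rwa [dist_comm])
    rw [torEval_proj, torEval_proj, Real.dist_eq] at h1
    have h2 := (abs_le.1 (abs_eval_le d Λ (q N - q') (gridθ d N L))).2
    rw [eval_sub] at h2
    have h3 := hqN.2 L
    rw [evalG] at h3
    linarith [(abs_lt.1 h1).2]

/-- `P log Q` is integrable when `Q` is positive, and its grid means converge to the integral. -/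
lemma logTerm_pos {d : ℕ} {Λ : Finset (Fin d → ℤ)} (P : (Fin d → ℤ) → ℂ) {Q : (Fin d → ℤ) → ℂ}
    (hQ : ∀ θ, 0 < eval d Λ Q θ) :
    Integrable (fun θ => eval d Λ P θ * Real.log (eval d Λ Q θ)) (dm d) ∧
    Filter.Tendsto (fun N => gmean d N fun θ => eval d Λ P θ * Real.log (eval d Λ Q θ))
      Filter.atTop (nhds (∫ θ, eval d Λ P θ * Real.log (eval d Λ Q θ) ∂(dm d))) := by
  have hpos (x : Tor d) : torEval d Λ Q x ≠ 0 := by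
    obtain ⟨θ, -, rfl⟩ := exists_Td_proj_eq d x
    rw [torEval_proj]
    exact (hQ θ).ne'
  have hc : Continuous fun x => torEval d Λ P x * Real.log (torEval d Λ Q x) :=
    (continuous_torEval d Λ P).mul ((continuous_torEval d Λ Q).log hpos)
  have h1 := integrable_proj d _ hc
  have h2 := tendsto_gmean d _ hc
  simp only [torEval_proj] at h1 h2
  exact ⟨h1, h2⟩

/-- A quantitative form of midpoint concavity of the logarithm. -/
lemma log_midpoint_ge {a b K : ℝ} (ha : 0 < a) (hb : 0 < b) (haK : a ≤ K) (hbK : b ≤ K) :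
    (Real.log a + Real.log b) / 2 + (a - b) ^ 2 / (8 * K ^ 2) ≤
      Real.log (2⁻¹ * a + 2⁻¹ * b) := by
  set m := 2⁻¹ * a + 2⁻¹ * b with hm
  have hm0 : 0 < m := by positivity
  have hmK : m ≤ K := by linarith
  have h1 := Real.log_le_sub_one_of_pos (show 0 < a * b / m ^ 2 by positivity)
  rw [Real.log_div (by positivity) (by positivity), Real.log_mul ha.ne' hb.ne', Real.log_pow] at h1
  have h2 : a * b / m ^ 2 - 1 = -((a - b) ^ 2 / (4 * m ^ 2)) := by
    field_simp
    rw [hm]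
    ring
  have h3 : (a - b) ^ 2 / (4 * K ^ 2) ≤ (a - b) ^ 2 / (4 * m ^ 2) := by gcongr
  have h4 : (a - b) ^ 2 / (8 * K ^ 2) = (a - b) ^ 2 / (4 * K ^ 2) / 2 := by
    rw [div_div]
    ring
  push_cast at h1
  rw [h4]
  linarith

/-- At a minimizer the logarithmic term is integrable, since otherwise scaling the minimizer down
would decrease the functional. -/
lemma integrable_logTerm_of_min {d : ℕ} {Λ : Finset (Fin d → ℤ)} (hΛ : ∀ k ∈ Λ, -k ∈ Λ)
    {c P Q : (Fin d → ℤ) → ℂ} (hc : c ∈ Cplus d Λ) (hQ : Q ∈ Pbar d Λ \ {0})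
    (hmin : ∀ Q' ∈ Pbar d Λ \ {0}, J d Λ c P Q ≤ J d Λ c P Q') :
    Integrable (fun θ => eval d Λ P θ * Real.log (eval d Λ Q θ)) (dm d) := by
  by_contra hni
  have hQ0 : Q ≠ 0 := hQ.2
  have hpair := hc.2 Q hQ.1 hQ0
  have hni' : ¬ Integrable (fun θ => eval d Λ P θ * Real.log (eval d Λ ((2⁻¹ : ℝ) • Q) θ))
      (dm d) := by
    intro hi
    apply hni
    have hP : Integrable (fun θ => eval d Λ P θ * Real.log 2⁻¹) (dm d) := by
      have := integrable_proj d _ (continuous_torEval d Λ P)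
      simp only [torEval_proj] at this
      exact this.mul_const _
    refine (hi.sub hP).congr ?_
    filter_upwards [ae_eval_ne_zero hΛ hQ.1.1 hQ0] with θ hθ
    rw [Pi.sub_apply, eval_smul, Real.log_mul (by norm_num) hθ]
    ring
  have := hmin ((2⁻¹ : ℝ) • Q) ⟨⟨hQ.1.1.smul _, fun θ hθ => by
    rw [eval_smul]
    have := hQ.1.2 θ hθ
    positivity⟩, by simpa using hQ0⟩
  rw [J, J, integral_undef hni, integral_undef hni', pair_smul] at this
  linarith

lemma J_add_cst_le {d : ℕ} {Λ : Finset (Fin d → ℤ)} (h0 : (0 : Fin d → ℤ) ∈ Λ)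
    (hΛ : ∀ k ∈ Λ, -k ∈ Λ) {c P Q : (Fin d → ℤ) → ℂ} (hP : P ∈ Pbar d Λ)
    (hQ : Q ∈ Pbar d Λ \ {0})
    (hint : Integrable (fun θ => eval d Λ P θ * Real.log (eval d Λ Q θ)) (dm d))
    {δ : ℝ} (hδ : 0 < δ) :
    J d Λ c P (Q + cst d δ) ≤ J d Λ c P Q + δ * (c 0).re := by
  have hpos (θ) : 0 < eval d Λ (Q + cst d δ) θ := by
    rw [eval_add, eval_cst h0]
    linarith [eval_nonneg hQ.1 θ]
  have hQ0 : Q ≠ 0 := hQ.2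
  have := integral_mono_ae hint (logTerm_pos P hpos).1 (by
    filter_upwards [ae_eval_ne_zero hΛ hQ.1.1 hQ0] with θ hθ
    have hθ' : 0 < eval d Λ Q θ := lt_of_le_of_ne (eval_nonneg hQ.1 θ) hθ.symm
    refine mul_le_mul_of_nonneg_left (Real.log_le_log hθ' ?_) (eval_nonneg hP θ)
    rw [eval_add, eval_cst h0]
    linarith)
  rw [J, J, pair_add, pair_cst h0]
  linarith

lemma le_of_mul_le_add_mul_log {t μ B C : ℝ} (hμ : 0 < μ) (hB : 0 ≤ B) (ht : 0 < t)
    (h : μ * t ≤ C + B * Real.log t) :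
    t ≤ 2 / μ * (C + B * (-1 - Real.log (μ / (2 * (B + 1))))) := by
  have hs : 0 < μ / (2 * (B + 1)) := by positivity
  have h1 := Real.log_le_sub_one_of_pos (mul_pos hs ht)
  rw [Real.log_mul hs.ne' ht.ne'] at h1
  set s := μ / (2 * (B + 1)) with hsdef
  have h2 : B * Real.log t ≤ B * (s * t) + B * (-1 - Real.log s) := by
    rw [← mul_add]
    exact mul_le_mul_of_nonneg_left (by linarith) hB
  have h3 : B * s ≤ μ / 2 := by
    rw [hsdef, mul_div_assoc', div_le_div_iff₀ (by positivity) (by norm_num)]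
    nlinarith
  have h4 : B * (s * t) ≤ μ / 2 * t := by
    rw [← mul_assoc]
    exact mul_le_mul_of_nonneg_right h3 ht.le
  rw [div_mul_eq_mul_div, le_div_iff₀ hμ]
  linarith

lemma nrm_pos {d : ℕ} {Λ : Finset (Fin d → ℤ)} {p : (Fin d → ℤ) → ℂ} (hp : IsCoeff d Λ p)
    (hp0 : p ≠ 0) : 0 < nrm d Λ p := by
  obtain ⟨k, hk⟩ := Function.ne_iff.1 hp0
  have hkΛ : k ∈ Λ := by
    by_contra h
    exact hk (hp.1 k h)
  exact Finset.sum_pos' (fun _ _ => norm_nonneg _) ⟨k, hkΛ, norm_pos_iff.2 hk⟩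

lemma norm_coeff_le_nrm {d : ℕ} {Λ : Finset (Fin d → ℤ)} {p : (Fin d → ℤ) → ℂ}
    (hp : IsCoeff d Λ p) (k : Fin d → ℤ) : ‖p k‖ ≤ nrm d Λ p := by
  by_cases hk : k ∈ Λ
  · exact Finset.single_le_sum (f := fun k => ‖p k‖) (fun _ _ => norm_nonneg _) hk
  · rw [hp.1 k hk, norm_zero]
    exact nrm_nonneg d Λ p

/-- Along an ultrafilter, coefficient vectors of bounded norm converge. -/
lemma exists_tendsto_of_nrm_le {ι : Type*} (g : Ultrafilter ι) {d : ℕ} {Λ : Finset (Fin d → ℤ)}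
    {q : ι → (Fin d → ℤ) → ℂ} {R : ℝ} (h : ∀ᶠ i in g, IsCoeff d Λ (q i) ∧ nrm d Λ (q i) ≤ R) :
    ∃ q', Filter.Tendsto q g (nhds q') := by
  have hK : IsCompact (Set.univ.pi fun _ : Fin d → ℤ => Metric.closedBall (0 : ℂ) R) :=
    isCompact_univ_pi fun _ => isCompact_closedBall 0 R
  obtain ⟨q', -, hq'⟩ := hK.ultrafilter_le_nhds (g.map q) (by
    refine Filter.le_principal_iff.2 (Filter.mem_map.2 ?_)
    filter_upwards [h] with i hi k _
    rw [mem_closedBall_zero_iff]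
    exact (norm_coeff_le_nrm hi.1 k).trans hi.2)
  exact ⟨q', hq'⟩

lemma pos_mem_domN {d : ℕ} {Λ : Finset (Fin d → ℤ)} {N : Fin d → ℕ} {P Q : (Fin d → ℤ) → ℂ}
    (hQ : IsCoeff d Λ Q) (hpos : ∀ θ, 0 < eval d Λ Q θ) : Q ∈ domN d Λ N P := by
  refine ⟨⟨hQ, fun L => (hpos _).le⟩, (pos_mem_Pbar hQ hpos).2, fun L => Or.inr (hpos _).ne'⟩

/-- The discrete minimizers stay bounded along every ultrafilter. -/
lemma eventually_nrm_le {d : ℕ} {Λ : Finset (Fin d → ℤ)} (h0 : (0 : Fin d → ℤ) ∈ Λ)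
    {c P : (Fin d → ℤ) → ℂ} (hc : c ∈ Cplus d Λ) (hP : P ∈ Pbar d Λ)
    (g : Ultrafilter (Fin d → ℕ)) (hg : (g : Filter (Fin d → ℕ)) ≤ Filter.atTop)
    {q : (Fin d → ℕ) → (Fin d → ℤ) → ℂ}
    (hq : ∀ᶠ N in g, q N ∈ domN d Λ N P ∧
      ∀ Q ∈ domN d Λ N P, JN d Λ N c P (q N) ≤ JN d Λ N c P Q) :
    ∃ R, ∀ᶠ N in g, nrm d Λ (q N) ≤ R := by
  let u (N : Fin d → ℕ) : (Fin d → ℤ) → ℂ := (nrm d Λ (q N))⁻¹ • q N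
  have hu : ∀ᶠ N in g, u N ∈ PbarN d Λ N ∧ nrm d Λ (u N) = 1 := by
    filter_upwards [hq] with N ⟨⟨hN, hN0, _⟩, _⟩
    have hn := nrm_pos hN.1 hN0
    refine ⟨⟨hN.1.smul _, fun L => ?_⟩, ?_⟩
    · rw [evalG, eval_smul]
      exact mul_nonneg (inv_nonneg.2 hn.le) (hN.2 L)
    · have : nrm d Λ (u N) = (nrm d Λ (q N))⁻¹ * nrm d Λ (q N) := by
        conv_lhs => unfold nrm
        conv_rhs => rw [nrm, Finset.mul_sum]
        refine Finset.sum_congr rfl fun k _ => ?_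
        simp only [u, Pi.smul_apply, norm_smul, norm_inv, Real.norm_of_nonneg hn.le]
        rfl
      rw [this, inv_mul_cancel₀ hn.ne']
  obtain ⟨u', hu'⟩ := exists_tendsto_of_nrm_le g (hu.mono fun N hN => ⟨hN.1.1, hN.2.le⟩)
  have hu'1 : nrm d Λ u' = 1 :=
    tendsto_nhds_unique_of_eventuallyEq (((continuous_nrm d Λ).tendsto _).comp hu')
      tendsto_const_nhds (hu.mono fun N hN => hN.2)
  have hu'0 : u' ≠ 0 := by
    rintro rfl
    simp [nrm] at hu'1
  have hμ := hc.2 u' (mem_Pbar_of_tendsto hg (hu.mono fun N hN => hN.1) hu') hu'0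
  set μ := pair d Λ c u'
  have hev := (((continuous_pair d Λ c).tendsto _).comp hu').eventually_const_lt (half_lt_self hμ)
  refine ⟨max 1 (2 / (μ / 2) * ((c 0).re + nrm d Λ P *
    (-1 - Real.log (μ / 2 / (2 * (nrm d Λ P + 1)))))), ?_⟩
  filter_upwards [hq, hev, Filter.Eventually.filter_mono hg (eventually_grid_fine d one_pos)]
    with N ⟨⟨hN, hN0, _⟩, hmin⟩ hpair ⟨hNpos, _⟩
  have hn := nrm_pos hN.1 hN0
  rcases le_total (nrm d Λ (q N)) 1 with h1 | h1
  · exact le_max_of_le_left h1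
  refine le_max_of_le_right (le_of_mul_le_add_mul_log (half_pos hμ) (nrm_nonneg d Λ P) hn ?_)
  have hone : ∀ θ, 0 < eval d Λ (cst d 1) θ := fun θ => by
    rw [eval_cst h0]
    exact one_pos
  have hle := hmin (cst d 1) (pos_mem_domN (isCoeff_cst h0 1) hone)
  rw [JN_eq, JN_eq, pair_cst h0] at hle
  simp only [eval_cst h0, Real.log_one, mul_zero] at hle
  have hzero : gmean d N (fun _ => 0) = 0 := by simp [gmean]
  have hmean : gmean d N (fun θ => eval d Λ P θ * Real.log (eval d Λ (q N) θ)) ≤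
      nrm d Λ P * Real.log (nrm d Λ (q N)) := by
    have := gmean_add_const d N hNpos (fun _ => 0) (nrm d Λ P * Real.log (nrm d Λ (q N)))
    rw [hzero, zero_add] at this
    rw [← this]
    refine gmean_mono d N fun L => ?_
    have hPL := eval_nonneg hP (gridθ d N L)
    have hlog : 0 ≤ Real.log (nrm d Λ (q N)) := Real.log_nonneg h1
    refine (mul_le_mul_of_nonneg_left ?_ hPL).trans
      (mul_le_mul_of_nonneg_right ((le_abs_self _).trans (abs_eval_le d Λ P _)) hlog)
    have hQL : 0 ≤ eval d Λ (q N) (gridθ d N L) := hN.2 L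
    rcases hQL.eq_or_lt with h | h
    · rw [← h, Real.log_zero]
      exact hlog
    · exact Real.log_le_log h ((le_abs_self _).trans (abs_eval_le d Λ _ _))
  have hscale : pair d Λ c (q N) = nrm d Λ (q N) * pair d Λ c (u N) := by
    rw [← pair_smul, smul_inv_smul₀ hn.ne']
  simp only [Function.comp_apply] at hpair
  rw [hscale] at hle
  nlinarith

/-- Every limit of discrete minimizers is nearly optimal for the continuous functional. -/
lemma J_limit_le {d : ℕ} {Λ : Finset (Fin d → ℤ)} (h0 : (0 : Fin d → ℤ) ∈ Λ)
    {c P : (Fin d → ℤ) → ℂ} (hP : P ∈ Pbar d Λ)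
    {l : Filter (Fin d → ℕ)} [l.NeBot] (hl : l ≤ Filter.atTop)
    {q : (Fin d → ℕ) → (Fin d → ℤ) → ℂ} {q' S : (Fin d → ℤ) → ℂ}
    (hq : ∀ᶠ N in l, q N ∈ domN d Λ N P ∧
      ∀ Q ∈ domN d Λ N P, JN d Λ N c P (q N) ≤ JN d Λ N c P Q)
    (hq' : q' ∈ Pbar d Λ) (h : Filter.Tendsto q l (nhds q'))
    (hS : IsCoeff d Λ S) (hSpos : ∀ θ, 0 < eval d Λ S θ) {δ : ℝ} (hδ : 0 < δ) :
    J d Λ c P (q' + cst d δ) ≤ J d Λ c P S + δ * (c 0).re := by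
  have hev (θ) : eval d Λ (q' + cst d δ) θ = eval d Λ q' θ + δ := by
    rw [eval_add, eval_cst h0]
  have hpos (θ) : 0 < eval d Λ (q' + cst d δ) θ := by
    rw [hev]
    linarith [eval_nonneg hq' θ]
  have hleft : Filter.Tendsto (fun N => pair d Λ c (q N) -
      (gmean d N (fun θ => eval d Λ P θ * Real.log (eval d Λ (q' + cst d δ) θ)) +
        nrm d Λ P * (nrm d Λ (q N - q') / δ))) l
      (nhds (pair d Λ c q' - ((∫ θ, eval d Λ P θ * Real.log (eval d Λ (q' + cst d δ) θ) ∂(dm d)) +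
        nrm d Λ P * (0 / δ)))) :=
    (((continuous_pair d Λ c).tendsto _).comp h).sub
      (((logTerm_pos P hpos).2.mono_left hl).add
        (((tendsto_nrm_sub d Λ h).div_const δ).const_mul _))
  have hright : Filter.Tendsto (fun N => JN d Λ N c P S) l (nhds (J d Λ c P S)) := by
    simp only [JN_eq]
    exact ((logTerm_pos P hSpos).2.mono_left hl).const_sub _
  have hle := le_of_tendsto_of_tendsto hleft hright (by
    filter_upwards [hq, Filter.Eventually.filter_mono hl (eventually_grid_fine d one_pos)]
      with N ⟨⟨hN, _, hdom⟩, hmin⟩ ⟨hNpos, _⟩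
    refine le_trans ?_ (hmin S (pos_mem_domN hS hSpos))
    rw [JN_eq, ← gmean_add_const d N hNpos]
    refine sub_le_sub_left (gmean_mono d N fun L => ?_) _
    have hPL := eval_nonneg hP (gridθ d N L)
    have hPB := (le_abs_self _).trans (abs_eval_le d Λ P (gridθ d N L))
    have hDL := (abs_le.1 (abs_eval_le d Λ (q N - q') (gridθ d N L))).2
    have hn := nrm_nonneg d Λ (q N - q')
    have hQL : 0 ≤ eval d Λ (q N) (gridθ d N L) := hN.2 L
    have hQ'L := eval_nonneg hq' (gridθ d N L)
    rw [eval_sub] at hDL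
    rw [hev]
    rcases hdom L with hz | hz
    · rw [evalG] at hz
      rw [hz]
      have := nrm_nonneg d Λ P
      simp only [zero_mul, zero_add]
      positivity
    · have hQL' : 0 < eval d Λ (q N) (gridθ d N L) := lt_of_le_of_ne hQL (Ne.symm hz)
      set a := eval d Λ (q N) (gridθ d N L)
      set b := eval d Λ q' (gridθ d N L)
      have hb : 0 < b + δ := by linarith
      have h1 := Real.log_le_sub_one_of_pos (div_pos hQL' hb)
      rw [Real.log_div hQL'.ne' hb.ne'] at h1
      have h2 : a / (b + δ) - 1 ≤ nrm d Λ (q N - q') / δ := by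
        have h3 : nrm d Λ (q N - q') / (b + δ) ≤ nrm d Λ (q N - q') / δ := by
          gcongr
          linarith
        refine le_trans ?_ h3
        rw [div_sub_one hb.ne']
        gcongr
        linarith
      calc eval d Λ P (gridθ d N L) * Real.log a
          ≤ eval d Λ P (gridθ d N L) * (Real.log (b + δ) + nrm d Λ (q N - q') / δ) :=
            mul_le_mul_of_nonneg_left (by linarith) hPL
        _ ≤ _ := by
            rw [mul_add]
            gcongr)
  rw [J, pair_add, pair_cst h0]
  simp only [zero_div, mul_zero, add_zero] at hle
  linarith

/-- Strong convexity of the continuous functional on positive polynomials. -/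
lemma J_midpoint {d : ℕ} {Λ : Finset (Fin d → ℤ)} {c P A S : (Fin d → ℤ) → ℂ}
    (hP : P ∈ Pbar d Λ) (hA : ∀ θ, 0 < eval d Λ A θ) (hS : ∀ θ, 0 < eval d Λ S θ) {K : ℝ}
    (hAK : nrm d Λ A ≤ K) (hSK : nrm d Λ S ≤ K) :
    J d Λ c P ((2⁻¹ : ℝ) • A + (2⁻¹ : ℝ) • S) +
      (∫ θ, eval d Λ P θ * (eval d Λ A θ - eval d Λ S θ) ^ 2 ∂(dm d)) / (8 * K ^ 2) ≤
      (J d Λ c P A + J d Λ c P S) / 2 := by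
  have hev (θ) : eval d Λ ((2⁻¹ : ℝ) • A + (2⁻¹ : ℝ) • S) θ =
      2⁻¹ * eval d Λ A θ + 2⁻¹ * eval d Λ S θ := by
    rw [eval_add, eval_smul, eval_smul]
  have hM (θ) : 0 < eval d Λ ((2⁻¹ : ℝ) • A + (2⁻¹ : ℝ) • S) θ := by
    rw [hev]
    linarith [hA θ, hS θ]
  have hIA := (logTerm_pos P hA).1
  have hIS := (logTerm_pos P hS).1
  have hIM := (logTerm_pos P hM).1
  have hIq : Integrable (fun θ => eval d Λ P θ * (eval d Λ A θ - eval d Λ S θ) ^ 2) (dm d) := by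
    have := integrable_proj d (fun x => torEval d Λ P x * (torEval d Λ A x - torEval d Λ S x) ^ 2)
      ((continuous_torEval d Λ P).mul
        (((continuous_torEval d Λ A).sub (continuous_torEval d Λ S)).pow 2))
    simpa only [torEval_proj] using this
  have hle := integral_mono (((hIA.add hIS).div_const 2).add (hIq.div_const (8 * K ^ 2))) hIM
    fun θ => by
      have h1 := log_midpoint_ge (hA θ) (hS θ)
        (((le_abs_self _).trans (abs_eval_le d Λ A θ)).trans hAK)
        (((le_abs_self _).trans (abs_eval_le d Λ S θ)).trans hSK)
      have h2 := mul_le_mul_of_nonneg_left h1 (eval_nonneg hP θ)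
      simp only [Pi.add_apply]
      rw [hev]
      refine le_trans (le_of_eq ?_) h2
      ring
  rw [integral_add' ((hIA.add hIS).div_const 2) (hIq.div_const _), integral_div, integral_div,
    integral_add' hIA hIS] at hle
  simp only [J, pair_add, pair_smul]
  linarith

/-- Two nearly optimal limits coincide. -/
lemma eq_of_nearly_optimal {d : ℕ} {Λ : Finset (Fin d → ℤ)} (h0 : (0 : Fin d → ℤ) ∈ Λ)
    (hΛ : ∀ k ∈ Λ, -k ∈ Λ) {c P Q q : (Fin d → ℤ) → ℂ} (hP : P ∈ Pbar d Λ \ {0})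
    (hQ : Q ∈ Pbar d Λ) (hq : q ∈ Pbar d Λ) {C : ℝ}
    (hmin : ∀ Q' ∈ Pbar d Λ \ {0}, J d Λ c P Q ≤ J d Λ c P Q')
    (hQδ : ∀ δ > 0, J d Λ c P (Q + cst d δ) ≤ J d Λ c P Q + δ * C)
    (hqδ : ∀ δ > 0, J d Λ c P (q + cst d δ) ≤ J d Λ c P Q + δ * C) : q = Q := by
  set I := ∫ θ, eval d Λ P θ * (eval d Λ q θ - eval d Λ Q θ) ^ 2 ∂(dm d) with hI
  have hnonneg (θ) : 0 ≤ eval d Λ P θ * (eval d Λ q θ - eval d Λ Q θ) ^ 2 :=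
    mul_nonneg (eval_nonneg hP.1 θ) (sq_nonneg _)
  have hcpos {p : (Fin d → ℤ) → ℂ} (hp : p ∈ Pbar d Λ) {δ : ℝ} (hδ : 0 < δ) (θ) :
      0 < eval d Λ (p + cst d δ) θ := by
    rw [eval_add, eval_cst h0]
    linarith [eval_nonneg hp θ]
  have hcnrm (p : (Fin d → ℤ) → ℂ) {δ : ℝ} (hδ : 0 < δ) (hδ1 : δ ≤ 1) :
      nrm d Λ (p + cst d δ) ≤ nrm d Λ p + 1 := by
    have h1 : nrm d Λ (cst d δ) ≤ 1 := by
      unfold nrm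
      rw [Finset.sum_eq_single_of_mem 0 h0 fun k _ hk => by simp [cst, hk]]
      simpa [cst, abs_of_pos hδ] using hδ1
    refine le_trans ?_ (add_le_add_right h1 _)
    unfold nrm
    rw [← Finset.sum_add_distrib]
    exact Finset.sum_le_sum fun k _ => norm_add_le _ _
  set K := nrm d Λ q + nrm d Λ Q + 1 with hK
  have hnq := nrm_nonneg d Λ q
  have hnQ := nrm_nonneg d Λ Q
  have hK0 : 0 < K := by positivity
  have key : ∀ δ ∈ Set.Ioc (0 : ℝ) 1, I / (8 * K ^ 2) ≤ δ * C := by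
    rintro δ ⟨hδ, hδ1⟩
    have hmid := J_midpoint (c := c) hP.1 (hcpos hq hδ) (hcpos hQ hδ) (K := K)
      ((hcnrm q hδ hδ1).trans (by linarith)) ((hcnrm Q hδ hδ1).trans (by linarith))
    have hdiff (θ) : eval d Λ (q + cst d δ) θ - eval d Λ (Q + cst d δ) θ =
        eval d Λ q θ - eval d Λ Q θ := by
      rw [eval_add, eval_add]
      ring
    simp only [hdiff] at hmid
    rw [← hI] at hmid
    have hm := hmin _ (pos_mem_Pbar
      (((hq.1.add (isCoeff_cst h0 δ)).smul 2⁻¹).add ((hQ.1.add (isCoeff_cst h0 δ)).smul 2⁻¹))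
      fun θ => by
        rw [eval_add, eval_smul, eval_smul]
        linarith [hcpos hq hδ θ, hcpos hQ hδ θ])
    linarith [hQδ δ hδ, hqδ δ hδ]
  have hI0 : I / (8 * K ^ 2) ≤ 0 := by
    have ht : Filter.Tendsto (fun δ : ℝ => δ * C) (nhdsWithin 0 (Set.Ioi 0)) (nhds (0 * C)) :=
      ((continuous_id.mul continuous_const).tendsto 0).mono_left nhdsWithin_le_nhds
    rw [zero_mul] at ht
    exact ge_of_tendsto ht (Filter.mem_of_superset (Ioc_mem_nhdsGT one_pos) key)
  have hI' : I = 0 := by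
    refine le_antisymm ?_ (integral_nonneg hnonneg)
    by_contra! h
    exact absurd (div_pos h (by positivity : 0 < 8 * K ^ 2)) hI0.not_gt
  have hIq : Integrable (fun θ => eval d Λ P θ * (eval d Λ q θ - eval d Λ Q θ) ^ 2) (dm d) := by
    have := integrable_proj d (fun x => torEval d Λ P x * (torEval d Λ q x - torEval d Λ Q x) ^ 2)
      ((continuous_torEval d Λ P).mul
        (((continuous_torEval d Λ q).sub (continuous_torEval d Λ Q)).pow 2))
    simpa only [torEval_proj] using this
  have hae := (integral_eq_zero_iff_of_nonneg hnonneg hIq).1 hI'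
  by_contra hne
  obtain ⟨θ, h1, h2, h3⟩ := (hae.and ((ae_eval_ne_zero hΛ hP.1.1 hP.2).and
    (ae_eval_ne_zero hΛ (hq.1.sub hQ.1) (sub_ne_zero.2 hne)))).exists
  rw [eval_sub] at h3
  exact mul_ne_zero h2 (pow_ne_zero 2 h3) h1

/-- if P ∈ 𝔓̄₊ \ {0} and c ∈ ℭ₊, Q̂ is the minimizer of the continuous
dual functional J_P over 𝔓̄₊ \ {0}, and Q̂_N are minimizers of the discrete dual
functionals J_P^N over 𝔓̄₊(N) (defined for minⱼ Nⱼ large), then Q̂_N → Q̂ uniformly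
on 𝕋^d as minⱼ Nⱼ → ∞. -/
theorem statement5 (d : ℕ) (hd : 1 ≤ d) (Λ : Finset (Fin d → ℤ))
    (h0 : (0 : Fin d → ℤ) ∈ Λ) (hΛ : ∀ k ∈ Λ, -k ∈ Λ)
    (c P : (Fin d → ℤ) → ℂ) (hc : c ∈ Cplus d Λ) (hP : P ∈ Pbar d Λ \ {0})
    (Qhat : (Fin d → ℤ) → ℂ) (hQhat : Qhat ∈ Pbar d Λ \ {0})
    (hmin : ∀ Q ∈ Pbar d Λ \ {0}, J d Λ c P Qhat ≤ J d Λ c P Q)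
    (QN : (Fin d → ℕ) → ((Fin d → ℤ) → ℂ)) (N₀ : ℕ)
    (hQN : ∀ N : Fin d → ℕ, (∀ j, N₀ ≤ N j) →
      c ∈ CplusN d Λ N ∧ QN N ∈ domN d Λ N P ∧
        ∀ Q ∈ domN d Λ N P, JN d Λ N c P (QN N) ≤ JN d Λ N c P Q) :
    ∀ ε > (0 : ℝ), ∃ M : ℕ, ∀ N : Fin d → ℕ, (∀ j, M ≤ N j) →
      ∀ θ ∈ Td d, |eval d Λ (QN N) θ - eval d Λ Qhat θ| < ε := by
  have hlim : Filter.Tendsto QN Filter.atTop (nhds Qhat) := by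
    rw [Filter.tendsto_iff_ultrafilter]
    intro g hg
    have hev : ∀ᶠ N in g, QN N ∈ domN d Λ N P ∧
        ∀ Q ∈ domN d Λ N P, JN d Λ N c P (QN N) ≤ JN d Λ N c P Q :=
      Filter.Eventually.filter_mono hg
        ((Filter.eventually_ge_atTop fun _ => N₀).mono fun N hN => (hQN N hN).2)
    obtain ⟨R, hR⟩ := eventually_nrm_le h0 hc hP.1 g hg hev
    obtain ⟨q, hq⟩ := exists_tendsto_of_nrm_le g
      ((hev.and hR).mono fun N hN => ⟨hN.1.1.1.1, hN.2⟩)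
    have hqP := mem_Pbar_of_tendsto hg (hev.mono fun N hN => hN.1.1) hq
    have hint := integrable_logTerm_of_min hΛ hc hQhat hmin
    have hS (δ : ℝ) (hδ : 0 < δ) := J_add_cst_le (c := c) h0 hΛ hP.1 hQhat hint hδ
    have hc0 : 0 < (c 0).re := by
      have hone : ∀ θ, 0 < eval d Λ (cst d 1) θ := fun θ => by
        rw [eval_cst h0]
        exact one_pos
      have h1 := pos_mem_Pbar (isCoeff_cst h0 1) hone
      have := hc.2 _ h1.1 h1.2
      rwa [pair_cst h0, one_mul] at this
    rw [← eq_of_nearly_optimal h0 hΛ hP hQhat.1 hqP hmin (C := 2 * (c 0).re)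
      (fun δ hδ => (hS δ hδ).trans (by nlinarith [mul_pos hδ hc0]))
      fun δ hδ => by
        have hA := J_limit_le h0 hP.1 hg hev hqP hq (hQhat.1.1.add (isCoeff_cst h0 δ))
          (fun θ => by
            rw [eval_add, eval_cst h0]
            linarith [eval_nonneg hQhat.1 θ]) hδ
        linarith [hS δ hδ]]
    exact hq
  intro ε hε
  obtain ⟨N₁, hN₁⟩ := Filter.eventually_atTop.1
    ((tendsto_nrm_sub d Λ hlim).eventually_lt_const hε)
  refine ⟨Finset.univ.sup N₁, fun N hN θ _ => ?_⟩
  rw [← eval_sub]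
  exact (abs_eval_le d Λ _ θ).trans_lt
    (hN₁ N fun j => (Finset.le_sup (Finset.mem_univ j)).trans (hN j))

end RCE
end
end

section
/- Suppose d ≥ 3 and the index set Λ contains three linearly independent vector-valued indices k₁, k₂, k₃. Then there exists Q ∈ ∂𝔓_+ (a nonnegative trigonometric polynomial with frequencies in Λ that vanishes at some point of 𝕋^d) such that ∫_{𝕋^d} (1/Q) dm < ∞. In particular, Q(e^{iθ}) = Σ_{ℓ=1}^3 (1 − cos(k_ℓ, θ)) is such a polynomial. -/
open MeasureTheory Complex Set

noncomputable section

namespace RCE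

/-- A basis of `ℝ^d` gives linear coordinates on `ℝ^d` by pairing with the basis vectors. -/
lemma exists_equiv_dotProduct {d : ℕ} {ι : Type*} [Fintype ι]
    (b : Module.Basis ι ℝ (Fin d → ℝ)) :
    ∃ e : (Fin d → ℝ) ≃L[ℝ] (ι → ℝ), ∀ θ i, e θ i = ∑ j, b i j * θ j := by
  let A : (Fin d → ℝ) →ₗ[ℝ] (ι → ℝ) := (Matrix.of fun i => b i).mulVecLin
  have hA : ∀ θ i, A θ i = b i ⬝ᵥ θ := fun θ i => rfl
  have hinj : Function.Injective A := by
    rw [injective_iff_map_eq_zero]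
    intro θ hθ
    refine dotProduct_self_eq_zero.1 ?_
    nth_rw 1 [← b.sum_repr θ]
    rw [sum_dotProduct]
    refine Finset.sum_eq_zero fun i _ => ?_
    rw [smul_dotProduct, ← hA, hθ, Pi.zero_apply, smul_zero]
  have hdim : Module.finrank ℝ (Fin d → ℝ) = Module.finrank ℝ (ι → ℝ) := by
    rw [Module.finrank_eq_card_basis b, Module.finrank_fintype_fun_eq_card]
  refine ⟨(A.linearEquivOfInjective hinj hdim).toContinuousLinearEquiv, fun θ i => ?_⟩
  exact hA θ i

/-- The push-forward of Lebesgue measure by a linear equivalence is a multiple of Lebesgue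
measure. -/
lemma exists_map_volume_eq_smul {ι κ : Type*} [Fintype ι] [Fintype κ]
    (e : (κ → ℝ) ≃L[ℝ] (ι → ℝ)) :
    ∃ c : NNReal, (volume : Measure (κ → ℝ)).map e = c • (volume : Measure (ι → ℝ)) :=
  have := e.isAddHaarMeasure_map (volume : Measure (κ → ℝ))
  ⟨_, Measure.isAddLeftInvariant_eq_smul _ _⟩

lemma integrable_comp_equiv {ι κ : Type*} [Fintype ι] [Fintype κ]
    (e : (κ → ℝ) ≃L[ℝ] (ι → ℝ)) {F : (ι → ℝ) → ℝ} (hF : Integrable F) :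
    Integrable fun θ => F (e θ) := by
  obtain ⟨c, hc⟩ := exists_map_volume_eq_smul e
  refine (e.toHomeomorph.measurableEmbedding.integrable_map_iff (g := F)).1 ?_
  change Integrable F (Measure.map e volume)
  rw [hc]
  exact hF.smul_measure_nnreal

lemma ae_comp_equiv {ι κ : Type*} [Fintype ι] [Fintype κ]
    (e : (κ → ℝ) ≃L[ℝ] (ι → ℝ)) {p : (ι → ℝ) → Prop} (hp : ∀ᵐ u, p u) :
    ∀ᵐ θ, p (e θ) := by
  obtain ⟨c, hc⟩ := exists_map_volume_eq_smul e
  refine ae_of_ae_map e.continuous.aemeasurable ?_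
  rw [hc]
  exact Measure.ae_smul_measure hp c

lemma one_sub_cos_nonneg (x : ℝ) : 0 ≤ 1 - Real.cos x := sub_nonneg.2 (Real.cos_le_one x)

/-- The function `u ↦ (1 - cos u)^{-1/3}`, truncated from below at `1`. -/
def weight (u : ℝ) : ℝ := max 1 ((1 - Real.cos u) ^ (-(1 / 3) : ℝ))

lemma one_le_weight (u : ℝ) : 1 ≤ weight u := le_max_left _ _

lemma measurable_weight : Measurable weight := by
  unfold weight
  fun_prop

lemma intervalIntegrable_weight (a b : ℝ) : IntervalIntegrable weight volume a b := by
  have hper : Function.Periodic weight (2 * Real.pi) := fun u => by simp [weight]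
  have hpi := Real.pi_pos
  have hpos : IntervalIntegrable weight volume 0 Real.pi := by
    have h1 : IntervalIntegrable
        (fun u : ℝ => 1 + (2 / Real.pi ^ 2) ^ (-(1 / 3) : ℝ) * u ^ (-(2 / 3) : ℝ))
        volume 0 Real.pi :=
      intervalIntegrable_const.add
        ((intervalIntegral.intervalIntegrable_rpow' (by norm_num)).const_mul _)
    refine h1.mono_fun' measurable_weight.aestronglyMeasurable ?_
    rw [uIoc_of_le hpi.le]
    refine (ae_restrict_iff' measurableSet_Ioc).2 (Filter.Eventually.of_forall fun u hu => ?_)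
    have hu0 : 0 < u := hu.1
    have hc : 0 < 2 / Real.pi ^ 2 := by positivity
    have hcos := Real.cos_le_one_sub_mul_cos_sq (x := u) (by rw [abs_of_pos hu0]; exact hu.2)
    have hle : (1 - Real.cos u) ^ (-(1 / 3) : ℝ)
        ≤ (2 / Real.pi ^ 2 * u ^ 2) ^ (-(1 / 3) : ℝ) :=
      Real.rpow_le_rpow_of_nonpos (by positivity) (by linarith) (by norm_num)
    rw [Real.mul_rpow hc.le (by positivity), ← Real.rpow_natCast u 2, ← Real.rpow_mul hu0.le,
      show ((2 : ℕ) : ℝ) * (-(1 / 3)) = -(2 / 3) by norm_num] at hle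
    have h2 : 0 ≤ (2 / Real.pi ^ 2) ^ (-(1 / 3) : ℝ) * u ^ (-(2 / 3) : ℝ) := by positivity
    beta_reduce
    rw [Real.norm_of_nonneg (zero_le_one.trans (one_le_weight u))]
    exact max_le (by linarith) (by linarith)
  have hneg : IntervalIntegrable weight volume (-Real.pi) 0 := by
    have h := hpos.comp_sub_left 0
    simp only [sub_zero, zero_sub] at h
    refine h.symm.congr fun u _ => ?_
    simp [weight]
  refine hper.intervalIntegrable (by positivity) (t := -Real.pi) ?_ a b
  rw [show -Real.pi + 2 * Real.pi = Real.pi by ring]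
  exact hneg.trans hpos

lemma ae_cos_lt_one : ∀ᵐ u : ℝ, Real.cos u < 1 := by
  have hc : {u : ℝ | Real.cos u = 1}.Countable :=
    (countable_range fun n : ℤ => (n : ℝ) * (2 * Real.pi)).mono
      fun u hu => (Real.cos_eq_one_iff u).1 hu
  filter_upwards [hc.ae_notMem volume] with u hu
  exact lt_of_le_of_ne (Real.cos_le_one u) hu

lemma inv_sum_le_prod_weight {u : Fin 3 → ℝ} (hu : ∀ ℓ, Real.cos (u ℓ) < 1) :
    (∑ ℓ, (1 - Real.cos (u ℓ)))⁻¹ ≤ ∏ ℓ, weight (u ℓ) := by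
  set q := ∑ ℓ, (1 - Real.cos (u ℓ))
  have hle : ∀ ℓ, 1 - Real.cos (u ℓ) ≤ q := fun ℓ =>
    Finset.single_le_sum (f := fun ℓ => 1 - Real.cos (u ℓ))
      (fun i _ => one_sub_cos_nonneg _) (Finset.mem_univ ℓ)
  have hq : 0 < q := (sub_pos.2 (hu 0)).trans_le (hle 0)
  calc q⁻¹ = ∏ _ℓ : Fin 3, q ^ (-(1 / 3) : ℝ) := by
        rw [Finset.prod_const, Finset.card_univ, Fintype.card_fin, ← Real.rpow_natCast,
          ← Real.rpow_mul hq.le, ← Real.rpow_neg_one]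
        norm_num
    _ ≤ ∏ ℓ, weight (u ℓ) := Finset.prod_le_prod (fun _ _ => by positivity) fun ℓ _ =>
        (Real.rpow_le_rpow_of_nonpos (sub_pos.2 (hu ℓ)) (hle ℓ) (by norm_num)).trans
          (le_max_right _ _)

/-- The reciprocal of `Σ_ℓ (1 - cos (k_ℓ, θ))` has finite integral over the torus when the three
frequencies are linearly independent. -/
lemma lintegral_inv_sum_one_sub_cos_lt_top {d : ℕ} (k : Fin 3 → Fin d → ℤ)
    (hind : LinearIndependent ℝ fun ℓ j => (k ℓ j : ℝ)) :
    ∫⁻ θ, ENNReal.ofReal (∑ ℓ, (1 - Real.cos (dotP d (k ℓ) θ)))⁻¹ ∂(dm d) < ⊤ := by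
  let b := Module.Basis.extend hind.linearIndepOn_id
  have : Fintype (hind.linearIndepOn_id.extend (subset_univ _)) :=
    FiniteDimensional.fintypeBasisIndex b
  let j : Fin 3 → hind.linearIndepOn_id.extend (subset_univ _) := fun ℓ =>
    ⟨fun i => (k ℓ i : ℝ), hind.linearIndepOn_id.subset_extend _ (mem_range_self ℓ)⟩
  have hj : Function.Injective j := fun ℓ m h => hind.injective (congrArg Subtype.val h)
  obtain ⟨e, he⟩ := exists_equiv_dotProduct b
  have hek : ∀ θ ℓ, dotP d (k ℓ) θ = e θ (j ℓ) := fun θ ℓ => by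
    rw [he, Module.Basis.extend_apply_self]
    rfl
  obtain ⟨R, hR⟩ : ∃ R : ℝ, ∀ θ ∈ Td d, ∀ i, e θ i ∈ Ioc (-R) R := by
    have hT : Bornology.IsBounded (e '' Td d) :=
      (((isCompact_univ_pi fun _ => isCompact_Icc).image e.continuous).isBounded).subset
        (image_mono (pi_mono fun _ _ => Ioc_subset_Icc_self))
    obtain ⟨R, hR⟩ := hT.exists_norm_le
    refine ⟨R + 1, fun θ hθ i => ?_⟩
    have := abs_le.1 ((norm_le_pi_norm (e θ) i).trans (hR _ (mem_image_of_mem e hθ)))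
    exact ⟨by linarith, by linarith⟩
  have hloc : Integrable ((Ioc (-R) R).indicator weight) :=
    (integrable_indicator_iff measurableSet_Ioc).2 (intervalIntegrable_weight (-R) R).1
  have hint := integrable_comp_equiv e
    (Integrable.fintype_prod (ι := hind.linearIndepOn_id.extend (subset_univ _))
      (f := fun _ => (Ioc (-R) R).indicator weight) (μ := fun _ => volume) fun _ => hloc)
  have hae : ∀ᵐ θ, ∀ i, Real.cos (e θ i) < 1 :=
    ae_comp_equiv e (ae_all_iff.2 fun i => Measure.tendsto_eval_ae_ae.eventually ae_cos_lt_one)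
  have hTm : MeasurableSet (Td d) := MeasurableSet.univ_pi fun _ => measurableSet_Ioc
  rw [dm, lintegral_smul_measure, smul_eq_mul]
  refine ENNReal.mul_lt_top (ENNReal.inv_lt_top.2 (ENNReal.ofReal_pos.2 (by positivity))) ?_
  refine lt_of_le_of_lt (lintegral_mono_ae ?_) hint.restrict.lintegral_lt_top
  filter_upwards [ae_restrict_of_ae hae, ae_restrict_mem hTm] with θ hθ hθT
  refine ENNReal.ofReal_le_ofReal ?_
  simp only [hek]
  refine (inv_sum_le_prod_weight fun ℓ => hθ (j ℓ)).trans ?_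
  simp only [indicator_of_mem (hR θ hθT _)]
  rw [← Finset.prod_image (f := fun i => weight (e θ i)) (g := j) hj.injOn]
  exact Finset.prod_le_prod_of_subset_of_one_le (Finset.subset_univ _)
    (fun _ _ => zero_le_one.trans (one_le_weight _)) fun _ _ _ => one_le_weight _

lemma eval_zero (d : ℕ) (Λ : Finset (Fin d → ℤ)) (θ : Fin d → ℝ) : eval d Λ 0 θ = 0 := by
  simp [eval]

lemma eval_single {d : ℕ} {Λ : Finset (Fin d → ℤ)} {k : Fin d → ℤ} (hk : k ∈ Λ) (c : ℝ)
    (θ : Fin d → ℝ) : eval d Λ (Pi.single k (c : ℂ)) θ = c * Real.cos (dotP d k θ) := by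
  rw [eval, Finset.sum_eq_single_of_mem k hk fun m _ hm => by
    rw [Pi.single_eq_of_ne hm, zero_mul], Pi.single_eq_same, ← ofReal_neg, re_ofReal_mul,
    exp_ofReal_mul_I_re, Real.cos_neg]

/-- The coefficient vector of `1 - cos (k, θ)`. -/
def oneSubCosCoeff {d : ℕ} (k : Fin d → ℤ) : (Fin d → ℤ) → ℂ :=
  Pi.single 0 ((1 : ℝ) : ℂ) -
    (Pi.single k ((1 / 2 : ℝ) : ℂ) + Pi.single (-k) ((1 / 2 : ℝ) : ℂ))

lemma isCoeff_oneSubCosCoeff {d : ℕ} {Λ : Finset (Fin d → ℤ)} (h0 : (0 : Fin d → ℤ) ∈ Λ)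
    (hΛ : ∀ k ∈ Λ, -k ∈ Λ) {k : Fin d → ℤ} (hk : k ∈ Λ) : IsCoeff d Λ (oneSubCosCoeff k) := by
  constructor
  · intro m hm
    have h1 : m ≠ 0 := fun h => hm (h ▸ h0)
    have h2 : m ≠ k := fun h => hm (h ▸ hk)
    have h3 : m ≠ -k := fun h => hm (h ▸ hΛ k hk)
    simp [oneSubCosCoeff, h1, h2, h3]
  · intro m
    simp only [oneSubCosCoeff, Pi.sub_apply, Pi.add_apply, Pi.single_apply, neg_eq_iff_eq_neg,
      neg_zero, neg_neg, map_sub, map_add, apply_ite (starRingEnd ℂ), conj_ofReal, map_zero]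
    ring

lemma eval_oneSubCosCoeff {d : ℕ} {Λ : Finset (Fin d → ℤ)} (h0 : (0 : Fin d → ℤ) ∈ Λ)
    (hΛ : ∀ k ∈ Λ, -k ∈ Λ) {k : Fin d → ℤ} (hk : k ∈ Λ) (θ : Fin d → ℝ) :
    eval d Λ (oneSubCosCoeff k) θ = 1 - Real.cos (dotP d k θ) := by
  have hzero : dotP d 0 θ = 0 := by simp [dotP]
  have hneg : dotP d (-k) θ = -dotP d k θ := by simp [dotP]
  rw [oneSubCosCoeff, eval_sub, eval_add, eval_single h0, eval_single hk, eval_single (hΛ k hk),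
    hzero, hneg, Real.cos_neg, Real.cos_zero]
  ring

/-- If `k` is nonzero, then `(k, θ) = π` for some `θ`. -/
lemma exists_dotP_eq_pi {d : ℕ} {k : Fin d → ℤ} (hk : k ≠ 0) : ∃ θ, dotP d k θ = Real.pi := by
  obtain ⟨i, hi⟩ := Function.ne_iff.1 hk
  have hi' : (k i : ℝ) ≠ 0 := Int.cast_ne_zero.2 hi
  refine ⟨Pi.single i (Real.pi / k i), ?_⟩
  rw [dotP, Finset.sum_eq_single_of_mem i (Finset.mem_univ i) fun j _ hj => by
    rw [Pi.single_eq_of_ne hj, mul_zero], Pi.single_eq_same]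
  exact mul_div_cancel₀ _ hi'

/-- for d ≥ 3, if Λ contains three linearly independent indices k₁,k₂,k₃,
then the assumption ∫ 1/Q dm = ∞ for Q ∈ ∂𝔓₊ fails: there is a nonzero
Q ∈ ∂𝔓₊ = 𝔓̄₊ \ 𝔓₊ with ∫ 1/Q dm < ∞; in particular the polynomial
Q(e^{iθ}) = Σ_{ℓ=1}^3 (1 − cos(k_ℓ,θ)) is such a polynomial. -/
theorem statement9 (d : ℕ) (hd : 3 ≤ d) (Λ : Finset (Fin d → ℤ))
    (h0 : (0 : Fin d → ℤ) ∈ Λ) (hΛ : ∀ k ∈ Λ, -k ∈ Λ)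
    (k₁ k₂ k₃ : Fin d → ℤ) (hk₁ : k₁ ∈ Λ) (hk₂ : k₂ ∈ Λ) (hk₃ : k₃ ∈ Λ)
    (hind : LinearIndependent ℝ
      ![(fun j => (k₁ j : ℝ)), (fun j => (k₂ j : ℝ)), (fun j => (k₃ j : ℝ))]) :
    (∃ Q ∈ Pbar d Λ \ Pplus d Λ, Q ≠ 0 ∧
      ∫⁻ θ, ENNReal.ofReal (eval d Λ Q θ)⁻¹ ∂(dm d) < ⊤) ∧
    ∀ Q : (Fin d → ℤ) → ℂ, IsCoeff d Λ Q →
      (∀ θ : Fin d → ℝ, eval d Λ Q θ =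
        ∑ ℓ : Fin 3, (1 - Real.cos (dotP d (![k₁, k₂, k₃] ℓ) θ))) →
      Q ∈ Pbar d Λ \ Pplus d Λ ∧ Q ≠ 0 ∧
        ∫⁻ θ, ENNReal.ofReal (eval d Λ Q θ)⁻¹ ∂(dm d) < ⊤ := by
  have hcoe : (fun (ℓ : Fin 3) (j : Fin d) => ((![k₁, k₂, k₃] ℓ j : ℤ) : ℝ)) =
      ![(fun j => (k₁ j : ℝ)), (fun j => (k₂ j : ℝ)), (fun j => (k₃ j : ℝ))] := by
    funext ℓ
    fin_cases ℓ <;> rfl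
  have hfin := lintegral_inv_sum_one_sub_cos_lt_top ![k₁, k₂, k₃] (hcoe ▸ hind)
  have hk₁0 : k₁ ≠ 0 := by
    rintro rfl
    exact hind.ne_zero 0 (funext fun _ => Int.cast_zero)
  have main : ∀ Q : (Fin d → ℤ) → ℂ, IsCoeff d Λ Q →
      (∀ θ : Fin d → ℝ, eval d Λ Q θ =
        ∑ ℓ : Fin 3, (1 - Real.cos (dotP d (![k₁, k₂, k₃] ℓ) θ))) →
      Q ∈ Pbar d Λ \ Pplus d Λ ∧ Q ≠ 0 ∧
        ∫⁻ θ, ENNReal.ofReal (eval d Λ Q θ)⁻¹ ∂(dm d) < ⊤ := by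
    intro Q hQ hev
    refine ⟨⟨⟨hQ, fun θ _ => ?_⟩, fun hpos => ?_⟩, ?_, ?_⟩
    · rw [hev]
      exact Finset.sum_nonneg fun ℓ _ => one_sub_cos_nonneg _
    · have hpi := Real.pi_pos
      have h := hpos.2 0 fun _ _ => ⟨neg_lt_zero.2 hpi, hpi.le⟩
      rw [hev] at h
      simp [dotP] at h
    · rintro rfl
      obtain ⟨θ, hθ⟩ := exists_dotP_eq_pi hk₁0
      have h := Finset.single_le_sum
        (f := fun ℓ : Fin 3 => 1 - Real.cos (dotP d (![k₁, k₂, k₃] ℓ) θ))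
        (fun ℓ _ => one_sub_cos_nonneg _) (Finset.mem_univ 0)
      rw [← hev, eval_zero] at h
      simp only [Matrix.cons_val_zero, hθ, Real.cos_pi] at h
      norm_num at h
    · simpa only [hev] using hfin
  refine ⟨⟨oneSubCosCoeff k₁ + oneSubCosCoeff k₂ + oneSubCosCoeff k₃, main _ ?_ fun θ => ?_⟩, main⟩
  · exact ((isCoeff_oneSubCosCoeff h0 hΛ hk₁).add (isCoeff_oneSubCosCoeff h0 hΛ hk₂)).add
      (isCoeff_oneSubCosCoeff h0 hΛ hk₃)
  · rw [eval_add, eval_add, eval_oneSubCosCoeff h0 hΛ hk₁, eval_oneSubCosCoeff h0 hΛ hk₂,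
      eval_oneSubCosCoeff h0 hΛ hk₃, Fin.sum_univ_three]
    rfl

end RCE
end
end
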